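/- arXiv:2305.02434 — 2 statements merged into one kernel-verified Lean document; each statement's English description precedes it below -/
import Mathlib

section
/- Assume p < 1/2 and n0 > 32C'²/α². Let λ = 1 − 4√2·C'/(√n0·α) (so λ ∈ (0,1)) and z = z_{λα/2}. Define p̂_{u,n0}^{BE} = (2Nn0 − z²n0 + √(4z²Nn0(N−n0) + z⁴n0²)) / (2N²) and p̂_{l,n0}^{BE} = (2Nn0 − z²n0 − √(4z²Nn0(N−n0) + z⁴n0²)) / (2N²). Then P(p̂_{l,n0}^{BE} ≤ p ≤ p̂_{u,n0}^{BE}) ≥ 1 − α. -/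
open MeasureTheory

open scoped Classical in
/-- Probability that the negative-binomial sample size `N` (number of Bernoulli(p) trials
until `n0` successes) satisfies predicate `Q`. -/
noncomputable def nbProb (n0 : ℕ) (p : ℝ) (Q : ℕ → Prop) : ℝ :=
  ∑' k : ℕ,
    if Q (n0 + k) then ((n0 + k - 1).choose (n0 - 1) : ℝ) * p ^ n0 * (1 - p) ^ k else 0

/-- The standard normal CDF. -/
noncomputable def Phi (x : ℝ) : ℝ :=
  ∫ t in Set.Iic x, Real.exp (-(t ^ 2) / 2) / Real.sqrt (2 * Real.pi)

/-- The negative binomial weights sum to one. -/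
lemma hasSum_nbWeight {n0 : ℕ} (hn0 : 1 ≤ n0) {p : ℝ} (hp : 0 < p) (hp1 : p < 1) :
    HasSum (fun k : ℕ => ((n0 + k - 1).choose (n0 - 1) : ℝ) * p ^ n0 * (1 - p) ^ k) 1 := by
  obtain ⟨j, rfl⟩ : ∃ j, n0 = j + 1 := ⟨n0 - 1, by omega⟩
  have hr : ‖1 - p‖ < 1 := by
    rw [Real.norm_eq_abs, abs_lt]
    constructor <;> linarith
  have h := (hasSum_choose_mul_geometric_of_norm_lt_one j hr).mul_left (p ^ (j + 1))
  have hone : p ^ (j + 1) * (1 / (1 - (1 - p)) ^ (j + 1)) = 1 := by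
    rw [sub_sub_cancel, mul_one_div_cancel (by positivity)]
  rw [hone] at h
  refine h.congr_fun ?_
  intro k
  have hk : j + 1 + k - 1 = k + j := by omega
  simp only [hk, Nat.add_sub_cancel]
  ring

/-- Union bound: three events that cover the support have total probability at least one. -/
lemma one_le_nbProb_add_add {n0 : ℕ} (hn0 : 1 ≤ n0) {p : ℝ} (hp : 0 < p) (hp1 : p < 1)
    {Q R S : ℕ → Prop} (hcover : ∀ m, n0 ≤ m → Q m ∨ R m ∨ S m) :
    1 ≤ nbProb n0 p Q + nbProb n0 p R + nbProb n0 p S := by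
  classical
  have hw := hasSum_nbWeight hn0 hp hp1
  have hnonneg : ∀ k : ℕ, 0 ≤ ((n0 + k - 1).choose (n0 - 1) : ℝ) * p ^ n0 * (1 - p) ^ k := by
    intro k
    have : 0 < 1 - p := by linarith
    positivity
  have hsum : ∀ T : ℕ → Prop, HasSum (fun k : ℕ => if T (n0 + k) then
      ((n0 + k - 1).choose (n0 - 1) : ℝ) * p ^ n0 * (1 - p) ^ k else 0) (nbProb n0 p T) := by
    intro T
    have hs : Summable (fun k : ℕ => if T (n0 + k) then
        ((n0 + k - 1).choose (n0 - 1) : ℝ) * p ^ n0 * (1 - p) ^ k else 0) := by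
      refine Summable.of_nonneg_of_le (fun k => ?_) (fun k => ?_) hw.summable
      · split_ifs
        exacts [hnonneg k, le_rfl]
      · split_ifs
        exacts [le_rfl, hnonneg k]
    unfold nbProb
    convert hs.hasSum
  refine hasSum_le (fun k => ?_) hw (((hsum Q).add (hsum R)).add (hsum S))
  have hk := hnonneg k
  have hc := hcover (n0 + k) (Nat.le_add_right _ _)
  split_ifs <;> first | linarith | tauto

lemma Phi_mono : Monotone Phi := by
  intro x y hxy
  have hint : Integrable (fun t : ℝ => Real.exp (-(t ^ 2) / 2) / Real.sqrt (2 * Real.pi)) := by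
    refine ((integrable_exp_neg_mul_sq (b := 1 / 2) (by norm_num)).div_const
      (Real.sqrt (2 * Real.pi))).congr ?_
    filter_upwards with t
    congr 2
    ring
  refine setIntegral_mono_set hint.integrableOn ?_ (Set.Iic_subset_Iic.2 hxy).eventuallyLE
  filter_upwards with t
  positivity

/-- The closed interval between the roots of the score quadratic contains `p` as soon as the
standardized deviation of `m` is at most `|z|`. -/
lemma mem_score_interval {m n p z : ℝ} (hm : 0 < m) (hn : 0 ≤ n) (hp1 : p ≤ 1)
    (h : |m * p - n| ≤ |z| * Real.sqrt (n * (1 - p))) :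
    (2 * m * n - z ^ 2 * n - Real.sqrt (4 * z ^ 2 * m * n * (m - n) + z ^ 4 * n ^ 2)) /
        (2 * m ^ 2) ≤ p ∧
      p ≤ (2 * m * n - z ^ 2 * n + Real.sqrt (4 * z ^ 2 * m * n * (m - n) + z ^ 4 * n ^ 2)) /
        (2 * m ^ 2) := by
  have hnp : 0 ≤ n * (1 - p) := mul_nonneg hn (by linarith)
  have hsq : (m * p - n) ^ 2 ≤ z ^ 2 * (n * (1 - p)) := by
    have := pow_le_pow_left₀ (abs_nonneg _) h 2
    rwa [mul_pow, sq_abs, sq_abs, Real.sq_sqrt hnp] at this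
  have habs : |2 * m ^ 2 * p - (2 * m * n - z ^ 2 * n)| ≤
      Real.sqrt (4 * z ^ 2 * m * n * (m - n) + z ^ 4 * n ^ 2) := by
    refine Real.abs_le_sqrt ?_
    nlinarith [mul_le_mul_of_nonneg_left hsq (by positivity : 0 ≤ 4 * m ^ 2)]
  obtain ⟨h1, h2⟩ := abs_le.1 habs
  constructor
  · rw [div_le_iff₀ (by positivity)]
    linarith
  · rw [le_div_iff₀ (by positivity)]
    linarith

/-- For `p ≤ 1 / 2` the Berry–Esseen error is at most its value at `p = 1 / 2`. -/
lemma berryEsseen_error_le {n p C : ℝ} (hn : 0 < n) (hp2 : p ≤ 1 / 2) (hC : 0 ≤ C) :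
    C / Real.sqrt (n * (1 - p) ^ 3) ≤ 2 * Real.sqrt 2 * C / Real.sqrt n := by
  have hcube : (1 / 2 : ℝ) ^ 3 ≤ (1 - p) ^ 3 := pow_le_pow_left₀ (by norm_num) (by linarith) 3
  have hle : Real.sqrt n ≤ 2 * Real.sqrt 2 * Real.sqrt (n * (1 - p) ^ 3) := by
    refine Real.sqrt_le_iff.2 ⟨by positivity, ?_⟩
    rw [mul_pow, mul_pow, Real.sq_sqrt (by norm_num),
      Real.sq_sqrt (mul_nonneg hn.le (le_trans (by norm_num) hcube))]
    nlinarith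
  have hpos : 0 < Real.sqrt (n * (1 - p) ^ 3) :=
    Real.sqrt_pos.2 (mul_pos hn (lt_of_lt_of_le (by norm_num) hcube))
  rw [div_le_div_iff₀ hpos (Real.sqrt_pos.2 hn)]
  nlinarith

/-- assume `p < 1/2`, `n0 > 32C'²/α²` and the Berry–Esseen-type bound with
constant `C'`. With `λ = 1 − 4√2·C'/(√n0·α)` and `z = z_{λα/2}`, the relaxed Berry–Esseen
CI `[p̂_{l,n0}^{BE}, p̂_{u,n0}^{BE}]` covers the true `p` with probability at least `1 − α`. -/
theorem stmt11 (n0 : ℕ) (hn0 : 1 ≤ n0) (p α C' : ℝ) (hp : 0 < p) (hp2 : p < 1 / 2)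
    (hα : 0 < α) (hα1 : α < 1) (hC' : 0 < C')
    (hn0big : (n0 : ℝ) > 32 * C' ^ 2 / α ^ 2)
    (zq : ℝ → ℝ) (hzq : ∀ q : ℝ, 0 < q → q < 1 → Phi (zq q) = q)
    (hBE1 : ∀ x : ℝ,
      |nbProb n0 p (fun m => (m : ℝ) ≤ x)
          - Phi ((x * p - n0) / Real.sqrt (n0 * (1 - p)))|
        ≤ C' / Real.sqrt (n0 * (1 - p) ^ 3))
    (hBE2 : ∀ x : ℝ,
      |nbProb n0 p (fun m => (m : ℝ) ≥ x)
          - Phi ((n0 - x * p) / Real.sqrt (n0 * (1 - p)))|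
        ≤ C' / Real.sqrt (n0 * (1 - p) ^ 3)) :
    nbProb n0 p (fun m =>
      let lam : ℝ := 1 - 4 * Real.sqrt 2 * C' / (Real.sqrt n0 * α)
      let z : ℝ := zq (lam * α / 2)
      (2 * m * n0 - z ^ 2 * n0 -
          Real.sqrt (4 * z ^ 2 * m * n0 * ((m : ℝ) - n0) + z ^ 4 * (n0 : ℝ) ^ 2)) /
          (2 * (m : ℝ) ^ 2) ≤ p ∧
      p ≤ (2 * m * n0 - z ^ 2 * n0 +
          Real.sqrt (4 * z ^ 2 * m * n0 * ((m : ℝ) - n0) + z ^ 4 * (n0 : ℝ) ^ 2)) /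
          (2 * (m : ℝ) ^ 2)) ≥ 1 - α := by
  have hn : (0 : ℝ) < n0 := by exact_mod_cast hn0
  have hsn : 0 < Real.sqrt n0 := Real.sqrt_pos.2 hn
  dsimp only
  set lam : ℝ := 1 - 4 * Real.sqrt 2 * C' / (Real.sqrt n0 * α) with hlam
  set z : ℝ := zq (lam * α / 2)
  set s : ℝ := Real.sqrt (n0 * (1 - p)) with hs
  have hspos : 0 < s := Real.sqrt_pos.2 (mul_pos hn (by linarith))
  have hlamα : lam * α = α - 4 * Real.sqrt 2 * C' / Real.sqrt n0 := by
    rw [hlam]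
    field_simp
  have hsmall : 4 * Real.sqrt 2 * C' / Real.sqrt n0 < α := by
    rw [div_lt_iff₀ hsn]
    refine lt_of_pow_lt_pow_left₀ 2 (by positivity) ?_
    rw [mul_pow, mul_pow, mul_pow, Real.sq_sqrt (by norm_num), Real.sq_sqrt hn.le]
    rw [gt_iff_lt, div_lt_iff₀ (by positivity)] at hn0big
    linarith
  have hpos : 0 < 4 * Real.sqrt 2 * C' / Real.sqrt n0 := by positivity
  have hPhi : Phi (-|z|) ≤ lam * α / 2 :=
    (Phi_mono (neg_abs_le z)).trans_eq (hzq _ (by linarith) (by linarith))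
  have herr := berryEsseen_error_le hn hp2.le hC'.le
  have hlower := (abs_le.1 (hBE1 ((n0 - |z| * s) / p))).2
  have hupper := (abs_le.1 (hBE2 ((n0 + |z| * s) / p))).2
  have harg1 : ((n0 - |z| * s) / p * p - n0) / s = -|z| := by
    field_simp
    ring
  have harg2 : (n0 - (n0 + |z| * s) / p * p) / s = -|z| := by
    field_simp
    ring
  rw [harg1] at hlower
  rw [harg2] at hupper
  have hcover := one_le_nbProb_add_add hn0 hp (by linarith : p < 1)
    (Q := fun m : ℕ =>
      (2 * m * n0 - z ^ 2 * n0 -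
          Real.sqrt (4 * z ^ 2 * m * n0 * ((m : ℝ) - n0) + z ^ 4 * (n0 : ℝ) ^ 2)) /
          (2 * (m : ℝ) ^ 2) ≤ p ∧
      p ≤ (2 * m * n0 - z ^ 2 * n0 +
          Real.sqrt (4 * z ^ 2 * m * n0 * ((m : ℝ) - n0) + z ^ 4 * (n0 : ℝ) ^ 2)) /
          (2 * (m : ℝ) ^ 2))
    (R := fun m : ℕ => (m : ℝ) ≤ (n0 - |z| * s) / p)
    (S := fun m : ℕ => (m : ℝ) ≥ (n0 + |z| * s) / p) (by
      intro m hm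
      have hmpos : (0 : ℝ) < m := by exact_mod_cast lt_of_lt_of_le hn0 hm
      by_cases hdev : |m * p - n0| ≤ |z| * s
      · exact Or.inl (mem_score_interval hmpos hn.le (by linarith) hdev)
      · right
        rw [ge_iff_le, le_div_iff₀ hp, div_le_iff₀ hp]
        rcases lt_abs.1 (not_le.1 hdev) with h | h
        · right
          linarith
        · left
          linarith)
  have hhalf : 4 * Real.sqrt 2 * C' / Real.sqrt n0 = 2 * (2 * Real.sqrt 2 * C' / Real.sqrt n0) := by
    ring
  linarith
end

section
/- For integers N ≥ n0 ≥ 1 with n0 > 32C'²/α², let λ = 1 − 4√2·C'/(√n0·α), z = z_{λα/2}, and define p̂_{u,n0}^{BE} = (2Nn0 − z²n0 + √(4z²Nn0(N−n0) + z⁴n0²)) / (2N²), p̂_{l,n0}^{BE} = (2Nn0 − z²n0 − √(4z²Nn0(N−n0) + z⁴n0²)) / (2N²), p̂_{u,n0}^{CLT} = n0/N + z_{1−α/2}√(n0(N−n0)/N³), and p̂_{l,n0}^{CLT} = n0/N − z_{1−α/2}√(n0(N−n0)/N³). Then there exists a constant C0', depending only on α and C' (not on n0 or N), such that for all such n0 and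 all N ≥ n0: p̂_{u,n0}^{BE} − p̂_{u,n0}^{CLT} ≤ C0'/N and p̂_{l,n0}^{CLT} − p̂_{l,n0}^{BE} ≤ C0'/N. -/
open MeasureTheory

lemma integrable_stdNormalDensity :
    Integrable (fun t : ℝ => Real.exp (-(t ^ 2) / 2) / Real.sqrt (2 * Real.pi)) := by
  have h := (integrable_exp_neg_mul_sq (b := 1 / 2) (by norm_num)).div_const
    (Real.sqrt (2 * Real.pi))
  refine h.congr (Filter.Eventually.of_forall fun t => ?_)
  simp only
  congr 2
  ring

lemma integral_stdNormalDensity :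
    ∫ t : ℝ, Real.exp (-(t ^ 2) / 2) / Real.sqrt (2 * Real.pi) = 1 := by
  have h := integral_gaussian (1 / 2)
  have e : ∀ t : ℝ, -(t ^ 2) / 2 = -(1 / 2) * t ^ 2 := fun t => by ring
  simp_rw [e]
  rw [integral_div, h, show Real.pi / (1 / 2) = 2 * Real.pi by ring]
  exact div_self (by positivity)

lemma Phi_neg (x : ℝ) : Phi (-x) = 1 - Phi x := by
  have h := integral_comp_neg_Iic (-x)
    (fun t : ℝ => Real.exp (-(t ^ 2) / 2) / Real.sqrt (2 * Real.pi))
  simp only [neg_sq, neg_neg] at h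
  have h' := intervalIntegral.integral_Iic_add_Ioi (b := x)
    integrable_stdNormalDensity.integrableOn integrable_stdNormalDensity.integrableOn
  rw [integral_stdNormalDensity] at h'
  unfold Phi
  linarith

/-- On `[m, -m]` the standard normal CDF grows at least at the rate of its density at `m`. -/
lemma mul_sub_le_Phi_sub {m a b : ℝ} (hma : m ≤ a) (hab : a ≤ b) (hbm : b ≤ -m) :
    Real.exp (-(m ^ 2) / 2) / Real.sqrt (2 * Real.pi) * (b - a) ≤ Phi b - Phi a := by
  unfold Phi
  rw [intervalIntegral.integral_Iic_sub_Iic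
    integrable_stdNormalDensity.integrableOn integrable_stdNormalDensity.integrableOn]
  have h := intervalIntegral.integral_mono_on (μ := volume) hab
    (intervalIntegrable_const (c := Real.exp (-(m ^ 2) / 2) / Real.sqrt (2 * Real.pi)))
    integrable_stdNormalDensity.intervalIntegrable
    (fun t ht => by
      have h1 := ht.1
      have h2 := ht.2
      have : t ^ 2 ≤ m ^ 2 := by nlinarith
      gcongr)
  rw [intervalIntegral.integral_const, smul_eq_mul] at h
  linarith

lemma Phi_strictMono : StrictMono Phi := by
  intro a b hab
  have h := mul_sub_le_Phi_sub (m := -(|a| + |b|)) (a := a) (b := b)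
    (by linarith [neg_abs_le a, abs_nonneg b]) hab.le (by linarith [le_abs_self b, abs_nonneg a])
  have : 0 < Real.exp (-((-(|a| + |b|)) ^ 2) / 2) / Real.sqrt (2 * Real.pi) * (b - a) :=
    mul_pos (by positivity) (sub_pos.2 hab)
  linarith

lemma Phi_zero : Phi 0 = 1 / 2 := by
  have h := Phi_neg 0
  rw [neg_zero] at h
  linarith

/-- The Wilson-type radius is at most the Wald-type radius plus a remainder. -/
lemma sqrt_wilson_le {z n N : ℝ} (hz : z ≤ 0) (hn : 0 ≤ n) (hN : 0 < N) (hnN : n ≤ N) :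
    Real.sqrt (4 * z ^ 2 * N * n * (N - n) + z ^ 4 * n ^ 2) ≤
      2 * N ^ 2 * (-z * Real.sqrt (n * (N - n) / N ^ 3)) + z ^ 2 * n := by
  have hr : 0 ≤ n * (N - n) / N ^ 3 :=
    div_nonneg (mul_nonneg hn (sub_nonneg.2 hnN)) (by positivity)
  have hsq := Real.sq_sqrt hr
  set r := Real.sqrt (n * (N - n) / N ^ 3)
  have hA : 0 ≤ 2 * N ^ 2 * (-z * r) :=
    mul_nonneg (by positivity) (mul_nonneg (by linarith) (Real.sqrt_nonneg _))
  have hB : 0 ≤ z ^ 2 * n := by positivity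
  have key : 4 * z ^ 2 * N * n * (N - n) = (2 * N ^ 2 * (-z * r)) ^ 2 := by
    have : (2 * N ^ 2 * (-z * r)) ^ 2 = 4 * N ^ 4 * z ^ 2 * r ^ 2 := by ring
    rw [this, hsq]
    field_simp
  refine Real.sqrt_le_iff.2 ⟨by positivity, ?_⟩
  rw [key]
  nlinarith [mul_nonneg hA hB]

lemma sqrt_wald_le {n N : ℝ} (hn : 0 ≤ n) (hN : 0 < N) :
    Real.sqrt (n * (N - n) / N ^ 3) ≤ Real.sqrt n / N := by
  refine Real.sqrt_le_iff.2 ⟨by positivity, ?_⟩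
  rw [div_pow, Real.sq_sqrt hn, div_le_div_iff₀ (by positivity) (by positivity)]
  have : 0 ≤ n ^ 2 * N ^ 2 := by positivity
  nlinarith

/-- Comparison of the two kinds of bounds, given a `O(1/√n)` gap between the quantiles. -/
lemma wilson_sub_wald_le {z m v n N K : ℝ} (hz : z ≤ 0) (hm : m ≤ z) (hn : 0 < n) (hnN : n ≤ N)
    (hK : 0 ≤ K) (hgap : -z - v ≤ K / Real.sqrt n) :
    ((2 * N * n - z ^ 2 * n + Real.sqrt (4 * z ^ 2 * N * n * (N - n) + z ^ 4 * n ^ 2)) /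
          (2 * N ^ 2) - (n / N + v * Real.sqrt (n * (N - n) / N ^ 3)) ≤ (K + m ^ 2) / N) ∧
      ((n / N - v * Real.sqrt (n * (N - n) / N ^ 3)) -
        (2 * N * n - z ^ 2 * n - Real.sqrt (4 * z ^ 2 * N * n * (N - n) + z ^ 4 * n ^ 2)) /
          (2 * N ^ 2) ≤ (K + m ^ 2) / N) := by
  have hN : 0 < N := hn.trans_le hnN
  have hS := sqrt_wilson_le hz hn.le hN hnN
  have hR := sqrt_wald_le hn.le hN
  have hR0 := Real.sqrt_nonneg (n * (N - n) / N ^ 3)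
  set S := Real.sqrt (4 * z ^ 2 * N * n * (N - n) + z ^ 4 * n ^ 2)
  set R := Real.sqrt (n * (N - n) / N ^ 3)
  have hsn : 0 < Real.sqrt n := Real.sqrt_pos.2 hn
  have hmain : (-z - v) * R ≤ K / N := by
    calc (-z - v) * R ≤ K / Real.sqrt n * R := by gcongr
      _ ≤ K / Real.sqrt n * (Real.sqrt n / N) := by gcongr
      _ = K / N := by field_simp
  have hS' : S / (2 * N ^ 2) ≤ -z * R + z ^ 2 * n / (2 * N ^ 2) := by
    rw [div_le_iff₀ (by positivity)]
    refine hS.trans (le_of_eq ?_)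
    field_simp
  have hzm : z ^ 2 * n / N ^ 2 ≤ m ^ 2 / N := by
    rw [div_le_div_iff₀ (by positivity) hN]
    have h1 : z ^ 2 ≤ m ^ 2 := by nlinarith
    calc z ^ 2 * n * N ≤ m ^ 2 * N * N := by gcongr
      _ = m ^ 2 * N ^ 2 := by ring
  have hm0 : 0 ≤ m ^ 2 / N := by positivity
  have e1 : (2 * N * n - z ^ 2 * n + S) / (2 * N ^ 2) =
      n / N - z ^ 2 * n / (2 * N ^ 2) + S / (2 * N ^ 2) := by field_simp
  have e2 : (2 * N * n - z ^ 2 * n - S) / (2 * N ^ 2) =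
      n / N - z ^ 2 * n / (2 * N ^ 2) - S / (2 * N ^ 2) := by field_simp
  have e3 : z ^ 2 * n / N ^ 2 = 2 * (z ^ 2 * n / (2 * N ^ 2)) := by field_simp
  rw [e1, e2, add_div]
  constructor <;> linarith

/-- with `λ = 1 − 4√2·C'/(√n0·α)`, `z = z_{λα/2}`, and the Berry–Esseen and
CLT bounds under targeted stopping as defined, there exists a constant `C0'` (depending
only on `α` and `C'`) such that for all integers `N ≥ n0 ≥ 1` with `n0 > 32C'²/α²`:
`p̂_{u,n0}^{BE} − p̂_{u,n0}^{CLT} ≤ C0'/N` and `p̂_{l,n0}^{CLT} − p̂_{l,n0}^{BE} ≤ C0'/N`. -/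
theorem stmt12 (α C' : ℝ) (hα : 0 < α) (hα1 : α < 1) (hC' : 0 < C')
    (zq : ℝ → ℝ) (hzq : ∀ q : ℝ, 0 < q → q < 1 → Phi (zq q) = q) :
    ∃ C0' : ℝ, ∀ n0 N : ℕ, 1 ≤ n0 → n0 ≤ N → (n0 : ℝ) > 32 * C' ^ 2 / α ^ 2 →
      let lam : ℝ := 1 - 4 * Real.sqrt 2 * C' / (Real.sqrt n0 * α)
      let z : ℝ := zq (lam * α / 2)
      ((2 * N * n0 - z ^ 2 * n0 +
          Real.sqrt (4 * z ^ 2 * N * n0 * ((N : ℝ) - n0) + z ^ 4 * (n0 : ℝ) ^ 2)) /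
          (2 * (N : ℝ) ^ 2)
        - ((n0 : ℝ) / N + zq (1 - α / 2) * Real.sqrt (n0 * ((N : ℝ) - n0) / (N : ℝ) ^ 3))
        ≤ C0' / N) ∧
      (((n0 : ℝ) / N - zq (1 - α / 2) * Real.sqrt (n0 * ((N : ℝ) - n0) / (N : ℝ) ^ 3))
        - (2 * N * n0 - z ^ 2 * n0 -
            Real.sqrt (4 * z ^ 2 * N * n0 * ((N : ℝ) - n0) + z ^ 4 * (n0 : ℝ) ^ 2)) /
            (2 * (N : ℝ) ^ 2)
        ≤ C0' / N) := by
  set n₁ : ℕ := ⌊32 * C' ^ 2 / α ^ 2⌋₊ + 1 with hn₁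
  set q : ℝ → ℝ := fun x => (1 - 4 * Real.sqrt 2 * C' / (Real.sqrt x * α)) * α / 2 with hq
  have hq_eq : ∀ x : ℝ, 0 < x → q x = α / 2 - 2 * Real.sqrt 2 * C' / Real.sqrt x := by
    intro x hx
    have := Real.sqrt_pos.2 hx
    simp only [hq]
    field_simp
    ring
  have hq_lt : ∀ x : ℝ, 0 < x → q x < α / 2 := by
    intro x hx
    rw [hq_eq x hx]
    have : 0 < 2 * Real.sqrt 2 * C' / Real.sqrt x := by positivity
    linarith
  have hT : 0 < 32 * C' ^ 2 / α ^ 2 := by positivity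
  have hq_pos : ∀ x : ℝ, 32 * C' ^ 2 / α ^ 2 < x → 0 < q x := by
    intro x hx
    have hx0 : 0 < x := hT.trans hx
    rw [hq_eq x hx0, sub_pos, div_lt_div_iff₀ (Real.sqrt_pos.2 hx0) two_pos]
    rw [div_lt_iff₀ (by positivity)] at hx
    refine lt_of_pow_lt_pow_left₀ 2 (by positivity) ?_
    have e : (2 * Real.sqrt 2 * C' * 2) ^ 2 = 16 * C' ^ 2 * Real.sqrt 2 ^ 2 := by ring
    rw [e, mul_pow, Real.sq_sqrt hx0.le, Real.sq_sqrt zero_le_two]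
    linarith
  have hn₁T : 32 * C' ^ 2 / α ^ 2 < (n₁ : ℝ) := by
    rw [hn₁, Nat.cast_add_one]
    exact Nat.lt_floor_add_one _
  have hn₁0 : (0 : ℝ) < n₁ := hT.trans hn₁T
  -- `n₁` is the smallest admissible sample size, so `m` bounds all the quantiles from below
  set m := zq (q n₁)
  have hΦm : Phi m = q n₁ := hzq _ (hq_pos _ hn₁T) (by linarith [hq_lt _ hn₁0])
  set v := zq (1 - α / 2)
  have hΦv : Phi (-v) = α / 2 := by
    rw [Phi_neg, hzq _ (by linarith) (by linarith)]
    ring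
  set c := Real.exp (-(m ^ 2) / 2) / Real.sqrt (2 * Real.pi) with hc
  have hc0 : 0 < c := by positivity
  refine ⟨2 * Real.sqrt 2 * C' / c + m ^ 2, ?_⟩
  intro n0 N hn0 hN hbig lam z
  have hn0' : (0 : ℝ) < n0 := by exact_mod_cast hn0
  have hle : (n₁ : ℝ) ≤ n0 := by
    have : ⌊32 * C' ^ 2 / α ^ 2⌋₊ < n0 := (Nat.floor_lt hT.le).2 hbig
    exact_mod_cast this
  have hΦz : Phi z = q n0 := hzq (q n0) (hq_pos _ hbig) (by linarith [hq_lt _ hn0'])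
  have hmz : m ≤ z := by
    rw [← Phi_strictMono.le_iff_le, hΦm, hΦz, hq_eq _ hn₁0, hq_eq _ hn0']
    gcongr
  have hzv : z ≤ -v := by
    rw [← Phi_strictMono.le_iff_le, hΦv, hΦz]
    exact (hq_lt _ hn0').le
  have hv0 : -v ≤ 0 := by
    rw [← Phi_strictMono.le_iff_le, hΦv, Phi_zero]
    linarith
  have hgap := mul_sub_le_Phi_sub hmz hzv (by linarith)
  rw [hΦv, hΦz, hq_eq _ hn0', sub_sub_cancel, ← hc] at hgap
  refine wilson_sub_wald_le (hzv.trans hv0) hmz hn0' (by exact_mod_cast hN) (by positivity) ?_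
  rw [div_right_comm, le_div_iff₀ hc0]
  linarith
end
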